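/- In the group algebra ℂ[D_6 × D_6], the subspace L spanned by (r,e) - (r²,e), (s,e) - (r²s,e), and (rs,e) - (r²s,e) satisfies: for every f ∈ L and every x ∈ (D_6 × {e}) ∪ ({e} × D_6), the element f·x^{-1} - x·f lies in L (where (f·x)(y) = f(yx), (x·f)(y) = f(x^{-1}y)); yet L is not a Lie ideal of ℂ[D_6 × D_6], since [(r,e) - (r²,e) + (s,e) - (r²s,e) + (rs,e) - (r²s,e), (r,r)] = -3(rs,r) + 3(s,r) ∉ L. -/

import Mathlib

open DihedralGroup

/-- In `ℂ[D₆ × D₆]`, the subspace `L` spanned by `(r,e) - (r²,e)`,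
`(s,e) - (r²s,e)` and `(rs,e) - (r²s,e)` is invariant under
`f ↦ f·x⁻¹ - x·f` for all `x ∈ (D₆ × {e}) ∪ ({e} × D₆)`, yet it is not a Lie ideal:
the commutator of `(r,e) - (r²,e) + (s,e) - (r²s,e) + (rs,e) - (r²s,e)` with `(r,r)`
equals `-3(rs,r) + 3(s,r) ∉ L`. -/
theorem not_lie_ideal_in_CD6xD6 :
    ∀ r s : DihedralGroup 3, r = DihedralGroup.r 1 → s = DihedralGroup.sr 0 →
    ∀ of : DihedralGroup 3 × DihedralGroup 3 →
        MonoidAlgebra ℂ (DihedralGroup 3 × DihedralGroup 3),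
      of = MonoidAlgebra.of ℂ (DihedralGroup 3 × DihedralGroup 3) →
    ∀ L : Submodule ℂ (MonoidAlgebra ℂ (DihedralGroup 3 × DihedralGroup 3)),
      L = Submodule.span ℂ
        { of (r, 1) - of (r * r, 1),
          of (s, 1) - of (r * r * s, 1),
          of (r * s, 1) - of (r * r * s, 1) } →
      -- invariance under f ↦ f·x⁻¹ - x·f for x in (D₆ × {e}) ∪ ({e} × D₆):
      (∀ f ∈ L, ∀ x : DihedralGroup 3 × DihedralGroup 3, (x.2 = 1 ∨ x.1 = 1) →
        f * of x - of x * f ∈ L) ∧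
      -- the explicit witness lies in L:
      (of (r, 1) - of (r * r, 1) + (of (s, 1) - of (r * r * s, 1)) +
          (of (r * s, 1) - of (r * r * s, 1)) ∈ L) ∧
      -- its commutator with (r,r) is -3(rs,r) + 3(s,r):
      ((of (r, 1) - of (r * r, 1) + (of (s, 1) - of (r * r * s, 1)) +
            (of (r * s, 1) - of (r * r * s, 1))) * of (r, r) -
          of (r, r) * (of (r, 1) - of (r * r, 1) + (of (s, 1) - of (r * r * s, 1)) +
            (of (r * s, 1) - of (r * r * s, 1))) =
        (-3 : ℂ) • of (r * s, r) + (3 : ℂ) • of (s, r)) ∧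
      -- which is not in L, so L is not a Lie ideal:
      ((-3 : ℂ) • of (r * s, r) + (3 : ℂ) • of (s, r) ∉ L) ∧
      ¬ (∀ f ∈ L, ∀ g : MonoidAlgebra ℂ (DihedralGroup 3 × DihedralGroup 3),
          f * g - g * f ∈ L) := by
  intro r s hr hs of hof L hL
  have hmul : ∀ x y, of x * of y = of (x * y) := by
    intro x y; rw [hof, map_mul]
  have hrr : r * r = DihedralGroup.r 2 := by subst hr; decide
  have hrs : r * s = DihedralGroup.sr 2 := by subst hr hs; decide
  have hrrs : r * r * s = DihedralGroup.sr 1 := by subst hr hs; decide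
  rw [hrrs, hrr, hrs, hr, hs] at hL
  rw [hrrs, hrr, hrs, hr, hs]
  have g1 : of (DihedralGroup.r 1, 1) - of (DihedralGroup.r 2, 1) ∈ L := by
    rw [hL]; exact Submodule.subset_span (by simp)
  have g2 : of (DihedralGroup.sr 0, 1) - of (DihedralGroup.sr 1, 1) ∈ L := by
    rw [hL]; exact Submodule.subset_span (by simp)
  have g3 : of (DihedralGroup.sr 2, 1) - of (DihedralGroup.sr 1, 1) ∈ L := by
    rw [hL]; exact Submodule.subset_span (by simp)
  have hsr1 : ∀ i : ZMod 3, of (DihedralGroup.sr i, 1) - of (DihedralGroup.sr 1, 1) ∈ L := by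
    intro i
    have hi : i = 0 ∨ i = 1 ∨ i = 2 := by revert i; decide
    rcases hi with rfl | rfl | rfl
    · exact g2
    · simp
    · exact g3
  have hsr : ∀ i j : ZMod 3, of (DihedralGroup.sr i, 1) - of (DihedralGroup.sr j, 1) ∈ L := by
    intro i j
    have := L.sub_mem (hsr1 i) (hsr1 j)
    rwa [sub_sub_sub_cancel_right] at this
  have hrot : ∀ i : ZMod 3, of (DihedralGroup.r i, 1) - of (DihedralGroup.r (-i), 1) ∈ L := by
    intro i
    have hi : i = 0 ∨ i = 1 ∨ i = 2 := by revert i; decide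
    rcases hi with rfl | rfl | rfl
    · simp
    · exact g1
    · have := L.neg_mem g1
      rwa [neg_sub] at this
  have c1 : ∀ d : DihedralGroup 3,
      (of (DihedralGroup.r 1, 1) - of (DihedralGroup.r 2, 1)) * of (d, 1)
        - of (d, 1) * (of (DihedralGroup.r 1, 1) - of (DihedralGroup.r 2, 1)) ∈ L := by
    intro d
    rw [sub_mul, mul_sub]
    simp only [hmul, Prod.mk_mul_mk, mul_one]
    rcases d with k | k
    · simp only [DihedralGroup.r_mul_r, add_comm, sub_self, L.zero_mem]
    · simp only [DihedralGroup.r_mul_sr, DihedralGroup.sr_mul_r]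
      exact L.sub_mem (hsr _ _) (hsr _ _)
  have c2 : ∀ (i j : ZMod 3) (d : DihedralGroup 3),
      (of (DihedralGroup.sr i, 1) - of (DihedralGroup.sr j, 1)) * of (d, 1)
        - of (d, 1) * (of (DihedralGroup.sr i, 1) - of (DihedralGroup.sr j, 1)) ∈ L := by
    intro i j d
    rw [sub_mul, mul_sub]
    simp only [hmul, Prod.mk_mul_mk, mul_one]
    rcases d with k | k
    · simp only [DihedralGroup.r_mul_sr, DihedralGroup.sr_mul_r]
      exact L.sub_mem (hsr _ _) (hsr _ _)
    · simp only [DihedralGroup.sr_mul_sr]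
      have := L.sub_mem (hrot (k - i)) (hrot (k - j))
      rw [neg_sub, neg_sub] at this
      rwa [sub_sub_sub_comm] 
  have hw : of (DihedralGroup.r 1, 1) - of (DihedralGroup.r 2, 1) +
      (of (DihedralGroup.sr 0, 1) - of (DihedralGroup.sr 1, 1)) +
          (of (DihedralGroup.sr 2, 1) - of (DihedralGroup.sr 1, 1)) ∈ L :=
    L.add_mem (L.add_mem g1 g2) g3
  have hc : (of (DihedralGroup.r 1, 1) - of (DihedralGroup.r 2, 1) +
      (of (DihedralGroup.sr 0, 1) - of (DihedralGroup.sr 1, 1)) +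
          (of (DihedralGroup.sr 2, 1) - of (DihedralGroup.sr 1, 1)))
            * of (DihedralGroup.r 1, DihedralGroup.r 1) -
      of (DihedralGroup.r 1, DihedralGroup.r 1) *
      (of (DihedralGroup.r 1, 1) - of (DihedralGroup.r 2, 1) +
      (of (DihedralGroup.sr 0, 1) - of (DihedralGroup.sr 1, 1)) +
          (of (DihedralGroup.sr 2, 1) - of (DihedralGroup.sr 1, 1))) =
      (-3 : ℂ) • of (DihedralGroup.sr 2, DihedralGroup.r 1)
        + (3 : ℂ) • of (DihedralGroup.sr 0, DihedralGroup.r 1) := by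
    simp only [sub_mul, mul_sub, add_mul, mul_add, hmul, Prod.mk_mul_mk, mul_one, one_mul,
      DihedralGroup.r_mul_sr, DihedralGroup.sr_mul_r, DihedralGroup.r_mul_r]
    have e1 : (0 + 1 : ZMod 3) = 1 := by decide
    have e2 : (1 + 1 : ZMod 3) = 2 := by decide
    have e3 : (2 + 1 : ZMod 3) = 0 := by decide
    have e4 : (1 + 2 : ZMod 3) = 0 := by decide
    have e5 : (0 - 1 : ZMod 3) = 2 := by decide
    have e6 : (1 - 1 : ZMod 3) = 0 := by decide
    have e7 : (2 - 1 : ZMod 3) = 1 := by decide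
    rw [e1, e2, e3, e4, e5, e6, e7]
    module
  have hn : (-3 : ℂ) • of (DihedralGroup.sr 2, DihedralGroup.r 1)
        + (3 : ℂ) • of (DihedralGroup.sr 0, DihedralGroup.r 1) ∉ L := by
    intro h
    rw [hL, Submodule.mem_span_triple] at h
    obtain ⟨a, b, c, h⟩ := h
    have h2 := congrArg (fun f => f.coeff (DihedralGroup.sr 0, DihedralGroup.r 1)) h
    have n1 : (DihedralGroup.r 1 : DihedralGroup 3) ≠ 1 := by decide
    have n2 : (2 : ZMod 3) ≠ 0 := by decide
    simp [hof, MonoidAlgebra.of_apply, n1, n2] at h2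
  refine ⟨?_, hw, hc, hn, fun H => hn (hc ▸ H _ hw _)⟩
  intro f hf x hx
  rcases x with ⟨x, y⟩
  rcases hx with hx | hx
  · simp only at hx
    subst hx
    rw [hL, Submodule.mem_span_triple] at hf
    obtain ⟨a, b, c, rfl⟩ := hf
    have := L.add_mem (L.add_mem (L.smul_mem a (c1 x)) (L.smul_mem b (c2 0 1 x)))
      (L.smul_mem c (c2 2 1 x))
    convert this using 1
    simp only [add_mul, mul_add, sub_mul, mul_sub, smul_mul_assoc, mul_smul_comm, smul_sub]
    abel
  · simp only at hx
    subst hx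
    rw [hL, Submodule.mem_span_triple] at hf
    obtain ⟨a, b, c, rfl⟩ := hf
    simp only [add_mul, mul_add, sub_mul, mul_sub, smul_mul_assoc, mul_smul_comm, hmul,
      Prod.mk_mul_mk, mul_one, one_mul, sub_self, L.zero_mem]
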